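/- Fix y ∈ C_{p+1,q}. Then: (i) for every g̃ ∈ U(p+1,q) there exists a unique x ∈ C_{p,q} such that π(g̃ · d_y · g̃⁻¹) ∈ O_x; (ii) the set Δ(y) = {x ∈ C_{p,q} : there exists g̃ ∈ U(p+1,q) with π(g̃ · d_y · g̃⁻¹) = d_x} is a convex subset of ℝⁿ and is a closed subset of ℝⁿ. -/

import Mathlib

open Matrix Complex Pointwise

noncomputable def Ipq (p q : ℕ) : Matrix (Fin (p + q)) (Fin (p + q)) ℂ :=
  Matrix.diagonal fun i => if (i : ℕ) < p then 1 else -1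

/-- The pseudo-unitary group `U(p,q)` as a set of matrices. -/
def Upq (p q : ℕ) : Set (Matrix (Fin (p + q)) (Fin (p + q)) ℂ) :=
  {g | IsUnit g ∧ g * Ipq p q * g.conjTranspose = Ipq p q}

/-- The diagonal matrix with entries `i * x_k`. -/
noncomputable def dmat {n : ℕ} (x : Fin n → ℝ) : Matrix (Fin n) (Fin n) ℂ :=
  Matrix.diagonal fun i => Complex.I * (x i : ℂ)

/-- The holomorphic chamber `C_{p,q}`: `x_1 ≥ ⋯ ≥ x_p > x_{p+1} ≥ ⋯ ≥ x_{p+q}`. -/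
def Chol (p q : ℕ) : Set (Fin (p + q) → ℝ) :=
  {x | (∀ i j : Fin (p + q), (i : ℕ) ≤ (j : ℕ) → ((j : ℕ) < p ∨ p ≤ (i : ℕ)) → x j ≤ x i) ∧
       ∀ i j : Fin (p + q), (i : ℕ) < p → p ≤ (j : ℕ) → x j < x i}

/-- The adjoint orbit `O_x = {g d_x g⁻¹ : g ∈ U(p,q)}`. -/
def Orbit (p q : ℕ) (x : Fin (p + q) → ℝ) : Set (Matrix (Fin (p + q)) (Fin (p + q)) ℂ) :=
  {Y | ∃ g ∈ Upq p q, Y = g * dmat x * g⁻¹}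

/-- The embedding `Fin (p+q) → Fin (p+1+q)` skipping the `(p+1)`-st index (0-based index `p`). -/
def embed (p q : ℕ) (i : Fin (p + q)) : Fin (p + 1 + q) :=
  if (i : ℕ) < p then ⟨(i : ℕ), by have := i.isLt; omega⟩
  else ⟨(i : ℕ) + 1, by have := i.isLt; omega⟩

/-- The projection `M_{ñ}(ℂ) → M_n(ℂ)` deleting the `(p+1)`-st row and column. -/
def projMat (p q : ℕ) (X : Matrix (Fin (p + 1 + q)) (Fin (p + 1 + q)) ℂ) :
    Matrix (Fin (p + q)) (Fin (p + q)) ℂ :=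
  fun i j => X (embed p q i) (embed p q j)

/-- If a Hermitian form is negative definite on a coordinate subspace of dimension `#T` (in the
coordinates given by `h`) and its restriction along `e` is positive definite on a coordinate
subspace of dimension `#S`, the two dimensions add up to at most the total dimension. -/
theorem card_add_card_le_of_neg_of_pos {ι κ : Type*} [Fintype ι] [DecidableEq ι] [Fintype κ]
    [DecidableEq κ] {M h : Matrix ι ι ℂ} (hh : IsUnit h) {α : ι → ℝ} {β : κ → ℝ} {e : κ → ι}
    (he : Function.Injective e)
    (hM : M = h * diagonal (fun i => (α i : ℂ)) * hᴴ)
    (hβ : M.submatrix e e = diagonal (fun i => (β i : ℂ)))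
    {S : Finset κ} {T : Finset ι} (hT : ∀ j ∈ T, α j < 0) (hS : ∀ i ∈ S, 0 < β i) :
    S.card + T.card ≤ Fintype.card ι := by
  by_contra! hcard
  let L : (ι → ℂ) →ₗ[ℂ] ({j // j ∉ S.image e} → ℂ) × ({j // j ∉ T} → ℂ) :=
    (LinearMap.funLeft ℂ ℂ Subtype.val).prod
      ((LinearMap.funLeft ℂ ℂ Subtype.val).comp (Matrix.mulVecLin hᴴ))
  have hlt : Module.finrank ℂ (({j // j ∉ S.image e} → ℂ) × ({j // j ∉ T} → ℂ)) <
      Module.finrank ℂ (ι → ℂ) := by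
    rw [Module.finrank_prod, Module.finrank_fintype_fun_eq_card,
      Module.finrank_fintype_fun_eq_card, Module.finrank_fintype_fun_eq_card,
      Fintype.card_subtype_compl, Fintype.card_subtype_compl, Fintype.card_coe, Fintype.card_coe,
      Finset.card_image_of_injective _ he]
    have h1 := Finset.card_le_univ T
    have h2 := Fintype.card_le_of_injective e he
    have h3 := Finset.card_le_univ S
    omega
  obtain ⟨u, hu, hu0⟩ := (Submodule.ne_bot_iff _).1 (LinearMap.ker_ne_bot_of_finrank_lt (f := L) hlt)
  have hL : L u = 0 := hu
  have huS : ∀ j, j ∉ S.image e → u j = 0 := fun j hj =>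
    congrFun (congrArg Prod.fst hL) ⟨j, hj⟩
  have huT : ∀ j, j ∉ T → (hᴴ *ᵥ u) j = 0 := fun j hj =>
    congrFun (congrArg Prod.snd hL) ⟨j, hj⟩
  have e1 : star u ⬝ᵥ (M *ᵥ u) = ((∑ j, α j * Complex.normSq ((hᴴ *ᵥ u) j) : ℝ) : ℂ) := by
    rw [hM, ← Matrix.mulVec_mulVec, ← Matrix.mulVec_mulVec, Matrix.dotProduct_mulVec]
    have : star u ᵥ* h = star (hᴴ *ᵥ u) := by
      rw [Matrix.star_mulVec, Matrix.conjTranspose_conjTranspose]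
    rw [this]
    simp only [dotProduct, Matrix.mulVec_diagonal, Pi.star_apply, RCLike.star_def]
    push_cast
    refine Finset.sum_congr rfl fun j _ => ?_
    rw [Complex.normSq_eq_conj_mul_self]; ring
  have e2 : star u ⬝ᵥ (M *ᵥ u) = ((∑ i, β i * Complex.normSq (u (e i)) : ℝ) : ℂ) := by
    have key : ∀ f : ι → ℂ, (∀ j, u j = 0 → f j = 0) → ∑ j, f j = ∑ i, f (e i) := by
      intro f hf
      rw [← Finset.sum_image (s := Finset.univ) (f := f) (g := e) (fun a _ b _ hab => he hab)]
      refine (Finset.sum_subset (Finset.subset_univ _) fun j _ hj => hf j (huS j fun hj' => hj ?_)).symm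
      exact Finset.image_subset_image (Finset.subset_univ S) hj'
    simp only [dotProduct, Matrix.mulVec]
    rw [key _ (fun j hj => by simp [hj])]
    push_cast
    refine Finset.sum_congr rfl fun i _ => ?_
    rw [key _ (fun j hj => by simp [hj])]
    have : ∀ i', M (e i) (e i') = diagonal (fun i => (β i : ℂ)) i i' := fun i' => by
      rw [← hβ]; rfl
    simp only [this, diagonal_apply, ite_mul, zero_mul, Finset.sum_ite_eq, Finset.mem_univ, if_true,
      Pi.star_apply, RCLike.star_def]
    rw [Complex.normSq_eq_conj_mul_self]; ring
  have hv0 : hᴴ *ᵥ u ≠ 0 := by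
    intro h0
    apply hu0
    have hinj := Matrix.mulVec_injective_of_isUnit ((Matrix.isUnit_conjTranspose _).2 hh)
    exact hinj (by rw [h0, Matrix.mulVec_zero])
  obtain ⟨j, hj⟩ := Function.ne_iff.1 hv0
  have hneg : ∑ j, α j * Complex.normSq ((hᴴ *ᵥ u) j) < 0 := by
    refine Finset.sum_neg' (fun k _ => ?_) ⟨j, Finset.mem_univ _, ?_⟩
    · by_cases hk : k ∈ T
      · exact mul_nonpos_of_nonpos_of_nonneg (hT k hk).le (Complex.normSq_nonneg _)
      · simp [huT k hk]
    · have hjT : j ∈ T := by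
        by_contra hjT
        exact hj (huT j hjT)
      exact mul_neg_of_neg_of_pos (hT j hjT) (Complex.normSq_pos.2 hj)
  have hpos : 0 ≤ ∑ i, β i * Complex.normSq (u (e i)) := by
    refine Finset.sum_nonneg fun i _ => ?_
    by_cases hi : i ∈ S
    · exact mul_nonneg (hS i hi).le (Complex.normSq_nonneg _)
    · have : u (e i) = 0 := huS _ fun h' => hi ((Finset.mem_image.1 h').elim
        fun a ha => he ha.2 ▸ ha.1)
      simp [this]
  have := Complex.ofReal_injective (e1.symm.trans e2)
  linarith

/-- The variant of `card_add_card_le_of_neg_of_pos` with both signs reversed. -/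
theorem card_add_card_le_of_pos_of_neg {ι κ : Type*} [Fintype ι] [DecidableEq ι] [Fintype κ]
    [DecidableEq κ] {M h : Matrix ι ι ℂ} (hh : IsUnit h) {α : ι → ℝ} {β : κ → ℝ} {e : κ → ι}
    (he : Function.Injective e)
    (hM : M = h * diagonal (fun i => (α i : ℂ)) * hᴴ)
    (hβ : M.submatrix e e = diagonal (fun i => (β i : ℂ)))
    {S : Finset κ} {T : Finset ι} (hT : ∀ j ∈ T, 0 < α j) (hS : ∀ i ∈ S, β i < 0) :
    S.card + T.card ≤ Fintype.card ι := by
  refine card_add_card_le_of_neg_of_pos (M := -M) (α := fun i => -α i) (β := fun i => -β i) hh he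
    ?_ ?_ (fun j hj => neg_lt_zero.2 (hT j hj)) (fun i hi => neg_pos.2 (hS i hi))
  · rw [hM, ← Matrix.neg_mul, ← Matrix.mul_neg, Matrix.diagonal_neg]
    simp
  · rw [Matrix.submatrix_neg, Pi.neg_apply, Pi.neg_apply, hβ, Matrix.diagonal_neg]
    simp

/-- Two antitone tuples with the same values, counted with multiplicity, are equal. -/
theorem eq_of_antitone_of_map_eq {n : ℕ} {f g : Fin n → ℝ} (hf : Antitone f) (hg : Antitone g)
    (h : Finset.univ.val.map f = Finset.univ.val.map g) : f = g := by
  rw [← List.ofFn_inj]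
  refine List.Perm.eq_of_pairwise' (r := (· ≥ ·)) ?_ ?_ ?_
  · exact List.pairwise_ofFn.2 fun i j hij => hf hij.le
  · exact List.pairwise_ofFn.2 fun i j hij => hg hij.le
  · rw [← Multiset.coe_eq_coe]
    simpa [Fin.univ_val_map] using h

/-- Antitone tuples are determined by the polynomial function with these roots. -/
theorem eq_of_antitone_of_prod_sub_eq {n : ℕ} {f g : Fin n → ℝ} (hf : Antitone f)
    (hg : Antitone g) (s : Set ℝ) (hs : s.Finite)
    (h : ∀ l ∉ s, ∏ i, (l - f i) = ∏ i, (l - g i)) : f = g := by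
  refine eq_of_antitone_of_map_eq hf hg ?_
  have hp : ∏ i, (Polynomial.X - Polynomial.C (f i)) = ∏ i, (Polynomial.X - Polynomial.C (g i)) := by
    refine Polynomial.eq_of_infinite_eval_eq _ _ (hs.infinite_compl.mono fun l hl => ?_)
    simpa [Polynomial.eval_prod] using h l hl
  have hroots : ∀ u : Fin n → ℝ, (∏ i, (Polynomial.X - Polynomial.C (u i))).roots =
      Finset.univ.val.map u := fun u => by
    rw [← Polynomial.roots_multiset_prod_X_sub_C (Finset.univ.val.map u), Multiset.map_map]
    rfl
  rw [← hroots, ← hroots, hp]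

/-- Partial fraction expansion of `(l - y₀) ∏ (l - z k) / (l - x k)` at simple poles. -/
theorem exists_partial_fractions {κ : Type*} [DecidableEq κ] (S : Finset κ) (x z : κ → ℝ) (y₀ : ℝ)
    (hx : Set.InjOn x S) :
    ∃ a : ℝ, ∀ l : ℝ, (∀ k ∈ S, l ≠ x k) →
      (l - y₀) * ∏ k ∈ S, (l - z k) / (l - x k) =
        l - a + ∑ i ∈ S, ((x i - y₀) * (x i - z i) *
          ∏ k ∈ S.erase i, (x i - z k) / (x i - x k)) / (l - x i) := by
  induction S using Finset.induction_on with
  | empty => exact ⟨y₀, by simp⟩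
  | insert m S hm ih =>
    obtain ⟨a, ha⟩ := ih (hx.mono (by simp))
    have hne : ∀ k ∈ S, x m ≠ x k := fun k hk hmk =>
      hm (hx (by simp) (by simp [hk]) hmk ▸ hk)
    refine ⟨a - (x m - z m), fun l hl => ?_⟩
    have hlm : l - x m ≠ 0 := sub_ne_zero.2 (hl m (by simp))
    rw [Finset.prod_insert hm, Finset.sum_insert hm, Finset.erase_insert hm, mul_assoc,
      mul_comm (x m - z m), ← mul_assoc (x m - y₀), ha (x m) hne, mul_left_comm,
      ha l (fun k hk => hl k (by simp [hk]))]
    have hr : ∀ i ∈ S, ((x i - y₀) * (x i - z i) *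
        ∏ k ∈ (insert m S).erase i, (x i - z k) / (x i - x k)) / (l - x i) =
        (l - z m) / (l - x m) * (((x i - y₀) * (x i - z i) *
          ∏ k ∈ S.erase i, (x i - z k) / (x i - x k)) / (l - x i)) -
        (x m - z m) / (l - x m) * (((x i - y₀) * (x i - z i) *
          ∏ k ∈ S.erase i, (x i - z k) / (x i - x k)) / (x m - x i)) := by
      intro i hi
      have him : m ≠ i := fun h => hm (h ▸ hi)
      rw [Finset.erase_insert_of_ne him, Finset.prod_insert (by simp [hm])]
      have h1 : l - x i ≠ 0 := sub_ne_zero.2 (hl i (by simp [hi]))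
      have h2 : x m - x i ≠ 0 := sub_ne_zero.2 (hne i hi)
      have h3 : x i - x m ≠ 0 := sub_ne_zero.2 (hne i hi).symm
      generalize ∏ k ∈ S.erase i, (x i - z k) / (x i - x k) = P
      have h4 : x i - x m = -(x m - x i) := by ring
      rw [h4]
      field_simp
      ring
    rw [Finset.sum_congr rfl hr, Finset.sum_sub_distrib, ← Finset.mul_sum, ← Finset.mul_sum]
    generalize ∑ i ∈ S, _ / (l - x i) = A
    generalize ∑ i ∈ S, _ / (x m - x i) = B
    field_simp
    ring

section

open scoped ComplexOrder

/-- The diagonal entries of `Ipq`. -/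
def sgn (p q : ℕ) (i : Fin (p + q)) : ℝ := if (i : ℕ) < p then 1 else -1

theorem sgn_of_lt {p q : ℕ} {i : Fin (p + q)} (h : (i : ℕ) < p) : sgn p q i = 1 := if_pos h

theorem sgn_of_le {p q : ℕ} {i : Fin (p + q)} (h : p ≤ (i : ℕ)) : sgn p q i = -1 :=
  if_neg h.not_gt

theorem sgn_mul_self (p q : ℕ) (i : Fin (p + q)) : sgn p q i * sgn p q i = 1 := by
  unfold sgn; split_ifs <;> norm_num

theorem sgn_ne_zero (p q : ℕ) (i : Fin (p + q)) : sgn p q i ≠ 0 := fun h => by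
  simpa [h] using sgn_mul_self p q i

theorem Ipq_eq (p q : ℕ) : Ipq p q = diagonal fun i => (sgn p q i : ℂ) := by
  unfold Ipq sgn
  congr 1
  ext i
  split_ifs <;> simp

theorem Ipq_mul_self (p q : ℕ) : Ipq p q * Ipq p q = 1 := by
  rw [Ipq_eq, diagonal_mul_diagonal, ← diagonal_one]
  congr 1
  ext i
  exact_mod_cast sgn_mul_self p q i

/-- The Hermitian matrix `g · diag(sgn · x) · gᴴ` attached to a point of the orbit of `dmat x`. -/
noncomputable def hermForm (p q : ℕ) (g : Matrix (Fin (p + q)) (Fin (p + q)) ℂ)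
    (x : Fin (p + q) → ℝ) : Matrix (Fin (p + q)) (Fin (p + q)) ℂ :=
  g * diagonal (fun i => ((sgn p q i * x i : ℝ) : ℂ)) * gᴴ

theorem conj_dmat_eq {p q : ℕ} {g : Matrix (Fin (p + q)) (Fin (p + q)) ℂ} (hg : g ∈ Upq p q)
    (x : Fin (p + q) → ℝ) :
    g * dmat x * g⁻¹ = Complex.I • (hermForm p q g x * Ipq p q) := by
  have hinv : g⁻¹ = Ipq p q * gᴴ * Ipq p q := by
    refine Matrix.inv_eq_right_inv ?_
    rw [← Matrix.mul_assoc, ← Matrix.mul_assoc, hg.2, Ipq_mul_self]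
  have hd : dmat x * Ipq p q =
      Complex.I • diagonal (fun i => ((sgn p q i * x i : ℝ) : ℂ)) := by
    rw [dmat, Ipq_eq, diagonal_mul_diagonal, ← diagonal_smul]
    congr 1
    ext i
    simp
    ring
  rw [hinv, hermForm, ← Matrix.mul_assoc, ← Matrix.mul_assoc, Matrix.mul_assoc g, hd]
  simp

theorem hermForm_sub {p q : ℕ} {g : Matrix (Fin (p + q)) (Fin (p + q)) ℂ} (hg : g ∈ Upq p q)
    (x : Fin (p + q) → ℝ) (l : ℝ) :
    hermForm p q g x - (l : ℂ) • Ipq p q = hermForm p q g (fun i => x i - l) := by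
  conv_lhs => rw [← hg.2]
  rw [hermForm, hermForm, Ipq_eq, ← Matrix.smul_mul, ← Matrix.mul_smul, ← Matrix.sub_mul,
    ← Matrix.mul_sub, ← diagonal_smul, diagonal_sub]
  congr 3
  ext i
  simp
  ring

theorem det_hermForm {p q : ℕ} {g : Matrix (Fin (p + q)) (Fin (p + q)) ℂ} (hg : g ∈ Upq p q)
    (x : Fin (p + q) → ℝ) :
    (hermForm p q g x).det = ((∏ i, sgn p q i * x i : ℝ) : ℂ) := by
  have h1 := congrArg Matrix.det hg.2
  have h2 : (Ipq p q).det ≠ 0 := by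
    intro h
    simpa [h] using congrArg Matrix.det (Ipq_mul_self p q)
  rw [det_mul, det_mul] at h1
  have h3 : g.det * gᴴ.det = 1 := mul_right_cancel₀ h2 (by rw [one_mul, mul_right_comm, h1])
  rw [hermForm, det_mul, det_mul, det_diagonal, mul_right_comm, h3, one_mul]
  push_cast
  rfl

theorem antitone_of_mem_Chol {p q : ℕ} {x : Fin (p + q) → ℝ} (hx : x ∈ Chol p q) :
    Antitone x := by
  intro i j hij
  by_cases h : (j : ℕ) < p ∨ p ≤ (i : ℕ)
  · exact hx.1 i j hij h
  · push Not at h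
    exact (hx.2 i j h.2 h.1).le

theorem eq_of_prod_sgn_mul_sub_eq {p q : ℕ} {x x' : Fin (p + q) → ℝ} (hx : x ∈ Chol p q)
    (hx' : x' ∈ Chol p q) (s : Set ℝ) (hs : s.Finite)
    (h : ∀ l ∉ s, ∏ i, sgn p q i * (x i - l) = ∏ i, sgn p q i * (x' i - l)) : x = x' := by
  refine eq_of_antitone_of_prod_sub_eq (antitone_of_mem_Chol hx) (antitone_of_mem_Chol hx') s hs
    fun l hl => ?_
  have h1 := h l hl
  rw [Finset.prod_mul_distrib, Finset.prod_mul_distrib] at h1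
  have h2 := mul_left_cancel₀ (Finset.prod_ne_zero_iff.2 fun i _ => sgn_ne_zero p q i) h1
  have h3 : ∀ u : Fin (p + q) → ℝ, ∏ i, (l - u i) = (∏ i : Fin (p + q), (-1 : ℝ)) * ∏ i, (u i - l) :=
    fun u => by
      rw [← Finset.prod_mul_distrib]
      exact Finset.prod_congr rfl fun i _ => by ring
  rw [h3, h3, h2]

theorem eq_of_hermForm_eq {p q : ℕ} {g g' : Matrix (Fin (p + q)) (Fin (p + q)) ℂ}
    (hg : g ∈ Upq p q) (hg' : g' ∈ Upq p q) {x x' : Fin (p + q) → ℝ} (hx : x ∈ Chol p q)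
    (hx' : x' ∈ Chol p q) (h : hermForm p q g x = hermForm p q g' x') : x = x' := by
  refine eq_of_prod_sgn_mul_sub_eq hx hx' ∅ Set.finite_empty fun l _ => ?_
  have h1 := det_hermForm hg (fun i => x i - l)
  rw [← hermForm_sub hg, h, hermForm_sub hg', det_hermForm hg'] at h1
  exact (Complex.ofReal_injective h1).symm

theorem posDef_hermForm {p q : ℕ} {g : Matrix (Fin (p + q)) (Fin (p + q)) ℂ} (hg : g ∈ Upq p q)
    {x : Fin (p + q) → ℝ} (hx : ∀ i, 0 < sgn p q i * x i) : (hermForm p q g x).PosDef := by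
  refine Matrix.PosDef.mul_mul_conjTranspose_same ?_ (Matrix.vecMul_injective_of_isUnit hg.1)
  exact Matrix.PosDef.diagonal fun i => by exact_mod_cast hx i

/-- Simultaneous diagonalisation of a positive definite and a Hermitian matrix by congruence. -/
theorem exists_simultaneous_diagonalization {ι : Type*} [Fintype ι] [DecidableEq ι]
    {P K : Matrix ι ι ℂ} (hP : P.PosDef) (hK : K.IsHermitian) :
    ∃ (h : Matrix ι ι ℂ) (m : ι → ℝ), IsUnit h ∧ P = h * hᴴ ∧
      K = h * diagonal (fun i => (m i : ℂ)) * hᴴ := by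
  obtain ⟨R, hR, rfl⟩ : ∃ R : Matrix ι ι ℂ, IsUnit R ∧ P = R * Rᴴ := by
    let d : Matrix ι ι ℂ := diagonal fun i => ((√(hP.1.eigenvalues i) : ℝ) : ℂ)
    have hd : d * dᴴ = diagonal (RCLike.ofReal ∘ hP.1.eigenvalues) := by
      rw [diagonal_conjTranspose, diagonal_mul_diagonal]
      congr 1
      ext i
      simp [← Complex.ofReal_mul, Real.mul_self_sqrt (hP.eigenvalues_pos i).le]
    have heq : P = (hP.1.eigenvectorUnitary : Matrix ι ι ℂ) * d *
        ((hP.1.eigenvectorUnitary : Matrix ι ι ℂ) * d)ᴴ := by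
      rw [conjTranspose_mul, Matrix.mul_assoc, ← Matrix.mul_assoc d, hd]
      conv_lhs => rw [hP.1.spectral_theorem]
      rw [Unitary.conjStarAlgAut_apply, Matrix.mul_assoc]
      rfl
    refine ⟨_, ?_, heq⟩
    have hu := hP.isUnit
    rw [heq] at hu
    rw [Matrix.isUnit_iff_isUnit_det, det_mul] at hu
    rw [Matrix.isUnit_iff_isUnit_det]
    exact isUnit_of_mul_isUnit_left hu
  have hL : (R⁻¹ * K * R⁻¹ᴴ).IsHermitian := Matrix.isHermitian_mul_mul_conjTranspose _ hK
  have hRdet := (Matrix.isUnit_iff_isUnit_det _).1 hR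
  have hRR : R * R⁻¹ = 1 := Matrix.mul_nonsing_inv _ hRdet
  have hV : (hL.eigenvectorUnitary : Matrix ι ι ℂ) * (hL.eigenvectorUnitary : Matrix ι ι ℂ)ᴴ = 1 :=
    Unitary.coe_mul_star_self _
  refine ⟨R * hL.eigenvectorUnitary, hL.eigenvalues, hR.mul ?_, ?_, ?_⟩
  · exact (Matrix.isUnit_iff_isUnit_det _).2 (Matrix.isUnit_det_of_right_inverse hV)
  · rw [conjTranspose_mul, Matrix.mul_assoc, ← Matrix.mul_assoc _ _ Rᴴ, hV, Matrix.one_mul]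
  · have hs : R⁻¹ * K * R⁻¹ᴴ = (hL.eigenvectorUnitary : Matrix ι ι ℂ) *
        diagonal (fun i => (hL.eigenvalues i : ℂ)) *
        (hL.eigenvectorUnitary : Matrix ι ι ℂ)ᴴ :=
      hL.spectral_theorem.trans (Unitary.conjStarAlgAut_apply _ _)
    calc K = (R * R⁻¹) * K * (R * R⁻¹)ᴴ := by simp [hRR]
      _ = R * (R⁻¹ * K * R⁻¹ᴴ) * Rᴴ := by rw [conjTranspose_mul]; simp only [Matrix.mul_assoc]
      _ = R * ((hL.eigenvectorUnitary : Matrix ι ι ℂ) *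
          diagonal (fun i => (hL.eigenvalues i : ℂ)) *
          (hL.eigenvectorUnitary : Matrix ι ι ℂ)ᴴ) * Rᴴ := congrArg (fun N => R * N * Rᴴ) hs
      _ = _ := by
        rw [conjTranspose_mul]
        simp only [Matrix.mul_assoc]

theorem mem_Upq_of_mul_eq {p q : ℕ} {g : Matrix (Fin (p + q)) (Fin (p + q)) ℂ}
    (h : g * Ipq p q * gᴴ = Ipq p q) : g ∈ Upq p q := by
  refine ⟨(Matrix.isUnit_iff_isUnit_det _).2
    (Matrix.isUnit_det_of_right_inverse (B := Ipq p q * gᴴ * Ipq p q) ?_), h⟩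
  rw [← Matrix.mul_assoc, ← Matrix.mul_assoc, h, Ipq_mul_self]

theorem card_filter_Ico {n : ℕ} (a b : ℕ) (hb : b ≤ n) :
    (Finset.univ.filter fun j : Fin n => a ≤ (j : ℕ) ∧ (j : ℕ) < b).card = b - a := by
  rw [← Nat.card_Ico a b, ← Finset.card_map Fin.valEmbedding]
  congr 1
  ext k
  simp only [Finset.mem_map, Finset.mem_filter, Finset.mem_univ, true_and, Fin.valEmbedding_apply,
    Finset.mem_Ico]
  exact ⟨fun ⟨j, hj, hjk⟩ => hjk ▸ hj, fun hk => ⟨⟨k, by omega⟩, hk, rfl⟩⟩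

theorem card_filter_not_Ico {n : ℕ} (a b : ℕ) (hb : b ≤ n) :
    (Finset.univ.filter fun j : Fin n => ¬(a ≤ (j : ℕ) ∧ (j : ℕ) < b)).card = n - (b - a) := by
  rw [Finset.filter_not, Finset.card_sdiff_of_subset (Finset.filter_subset _ _), card_filter_Ico a b hb,
    Finset.card_univ, Fintype.card_fin]

/-- Sylvester's law of inertia for `Ipq`. -/
theorem card_filter_pos_of_Ipq_eq {p q : ℕ} {h : Matrix (Fin (p + q)) (Fin (p + q)) ℂ}
    (hh : IsUnit h) {m : Fin (p + q) → ℝ} (hm : ∀ i, m i ≠ 0)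
    (hJ : Ipq p q = h * diagonal (fun i => (m i : ℂ)) * hᴴ) :
    (Finset.univ.filter fun i => 0 < m i).card = p := by
  have h1 := card_add_card_le_of_neg_of_pos (e := id) hh Function.injective_id hJ
    (by rw [submatrix_id_id]; exact Ipq_eq p q)
    (S := Finset.univ.filter fun i => 0 ≤ (i : ℕ) ∧ (i : ℕ) < p)
    (T := Finset.univ.filter fun i => ¬ 0 < m i)
    (fun j hj => lt_of_le_of_ne (not_lt.1 (Finset.mem_filter.1 hj).2) (hm j))
    (fun i hi => by rw [sgn_of_lt (Finset.mem_filter.1 hi).2.2]; norm_num)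
  have h2 := card_add_card_le_of_pos_of_neg (e := id) hh Function.injective_id hJ
    (by rw [submatrix_id_id]; exact Ipq_eq p q)
    (S := Finset.univ.filter fun i => p ≤ (i : ℕ) ∧ (i : ℕ) < p + q)
    (T := Finset.univ.filter fun i => 0 < m i)
    (fun j hj => (Finset.mem_filter.1 hj).2)
    (fun i hi => by rw [sgn_of_le (Finset.mem_filter.1 hi).2.1]; norm_num)
  have h3 := Finset.card_filter_add_card_filter_not (s := Finset.univ) (fun i => 0 < m i)
  rw [card_filter_Ico _ _ (by omega), Fintype.card_fin] at h1 h2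
  rw [Finset.card_univ, Fintype.card_fin] at h3
  omega

theorem mul_diagonal_conj_submatrix {ι : Type*} [Fintype ι] [DecidableEq ι] (h : Matrix ι ι ℂ)
    (d : ι → ℂ) (t : Equiv.Perm ι) :
    h.submatrix id t * diagonal (d ∘ t) * (h.submatrix id t)ᴴ = h * diagonal d * hᴴ := by
  rw [conjTranspose_submatrix, ← submatrix_diagonal_equiv, submatrix_mul_equiv,
    submatrix_mul_equiv, submatrix_id_id]

/-- A Hermitian matrix `B` such that `B - c • Ipq` is positive definite comes from an elliptic
element whose eigenvalues lie in the holomorphic chamber. -/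
theorem exists_eq_hermForm {p q : ℕ} {B : Matrix (Fin (p + q)) (Fin (p + q)) ℂ} {c : ℝ}
    (hB : (B - (c : ℂ) • Ipq p q).PosDef) :
    ∃ x ∈ Chol p q, ∃ g ∈ Upq p q, B = hermForm p q g x := by
  have hJherm : (Ipq p q).IsHermitian := by
    rw [Ipq_eq]
    exact isHermitian_diagonal_of_self_adjoint _ (by ext i; simp)
  obtain ⟨h₀, m₀, hh₀, hP₀, hJ₀⟩ := exists_simultaneous_diagonalization hB hJherm
  obtain ⟨h, m, hh, hP, hJ, hanti⟩ : ∃ (h : Matrix (Fin (p + q)) (Fin (p + q)) ℂ)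
      (m : Fin (p + q) → ℝ), IsUnit h ∧ B - (c : ℂ) • Ipq p q = h * hᴴ ∧
      Ipq p q = h * diagonal (fun i => (m i : ℂ)) * hᴴ ∧ Antitone fun i => (m i)⁻¹ := by
    let t := Tuple.sort fun i => -(m₀ i)⁻¹
    have ht : Monotone ((fun i => -(m₀ i)⁻¹) ∘ t) := Tuple.monotone_sort _
    have hP₁ := mul_diagonal_conj_submatrix h₀ (fun _ => 1) t
    have hc : ((fun _ => 1 : Fin (p + q) → ℂ) ∘ t) = fun _ => 1 := rfl
    rw [hc, diagonal_one, Matrix.mul_one, Matrix.mul_one] at hP₁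
    refine ⟨h₀.submatrix id t, m₀ ∘ t, ?_, ?_, ?_, fun i j hij => neg_le_neg_iff.1 (ht hij)⟩
    · have hu := hB.isUnit
      rw [hP₀, ← hP₁, Matrix.isUnit_iff_isUnit_det, det_mul] at hu
      exact (Matrix.isUnit_iff_isUnit_det _).2 (isUnit_of_mul_isUnit_left hu)
    · rw [hP₀, hP₁]
    · exact hJ₀.trans (mul_diagonal_conj_submatrix h₀ _ t).symm
  have hm : ∀ i, m i ≠ 0 := by
    have hdet := congrArg Matrix.det (Ipq_mul_self p q)
    rw [hJ, det_mul, det_mul, det_mul, det_diagonal] at hdet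
    intro i hi
    rw [Finset.prod_eq_zero (Finset.mem_univ i) (by simp [hi])] at hdet
    simp at hdet
  have hcard := card_filter_pos_of_Ipq_eq hh hm hJ
  have hlower : ∀ i j : Fin (p + q), i ≤ j → 0 < m j → 0 < m i := fun i j hij hj =>
    inv_pos.1 ((inv_pos.2 hj).trans_le (hanti hij))
  have hpos : ∀ i : Fin (p + q), (i : ℕ) < p → 0 < m i := by
    intro i hi
    by_contra hmi
    have hsub : (Finset.univ.filter fun i => 0 < m i) ⊆
        Finset.univ.filter fun j : Fin (p + q) => 0 ≤ (j : ℕ) ∧ (j : ℕ) < i := fun j hj => by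
      simp only [Finset.mem_filter, Finset.mem_univ, true_and, zero_le] at hj ⊢
      by_contra hij
      exact hmi (hlower i j (not_lt.1 hij) hj)
    have := Finset.card_le_card hsub
    rw [hcard, card_filter_Ico _ _ i.2.le] at this
    omega
  have hneg : ∀ i : Fin (p + q), p ≤ (i : ℕ) → m i < 0 := by
    intro i hi
    by_contra hmi
    have hmi' : 0 < m i := lt_of_le_of_ne (not_lt.1 hmi) (hm i).symm
    have hsub : (Finset.univ.filter fun j : Fin (p + q) => 0 ≤ (j : ℕ) ∧ (j : ℕ) < i + 1) ⊆
        Finset.univ.filter fun i => 0 < m i := fun j hj => by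
      simp only [Finset.mem_filter, Finset.mem_univ, true_and, zero_le] at hj ⊢
      exact hlower j i (Nat.lt_succ_iff.1 hj) hmi'
    have := Finset.card_le_card hsub
    rw [hcard, card_filter_Ico _ _ i.2] at this
    omega
  have hsm : ∀ i, 0 < sgn p q i * m i := by
    intro i
    rcases lt_or_ge (i : ℕ) p with hi | hi
    · rw [sgn_of_lt hi]; linarith [hpos i hi]
    · rw [sgn_of_le hi]; linarith [hneg i hi]
  let d : Matrix (Fin (p + q)) (Fin (p + q)) ℂ :=
    diagonal fun i => ((√(sgn p q i * m i) : ℝ) : ℂ)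
  have hconj : ∀ u : Fin (p + q) → ℝ, (h * d) * diagonal (fun i => (u i : ℂ)) * (h * d)ᴴ =
      h * diagonal (fun i => ((sgn p q i * m i * u i : ℝ) : ℂ)) * hᴴ := by
    intro u
    have : d * diagonal (fun i => (u i : ℂ)) * dᴴ =
        diagonal (fun i => ((sgn p q i * m i * u i : ℝ) : ℂ)) := by
      rw [diagonal_conjTranspose, diagonal_mul_diagonal, diagonal_mul_diagonal]
      congr 1
      ext i
      rw [Pi.star_apply, RCLike.star_def, Complex.conj_ofReal, ← Complex.ofReal_mul,
        ← Complex.ofReal_mul, mul_right_comm, Real.mul_self_sqrt (hsm i).le]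
    rw [← this, conjTranspose_mul]
    simp only [Matrix.mul_assoc]
  refine ⟨fun i => c + (m i)⁻¹, ⟨fun i j hij _ => ?_, fun i j hi hj => ?_⟩, h * d,
    mem_Upq_of_mul_eq ?_, ?_⟩
  · have := hanti (show i ≤ j from hij)
    simp only at this
    linarith
  · have h1 := inv_pos.2 (hpos i hi)
    have h2 := inv_lt_zero.2 (hneg j hj)
    linarith
  · conv_lhs => rw [Ipq_eq, hconj]
    rw [hJ]
    congr 3
    ext i
    rw [mul_right_comm, sgn_mul_self, one_mul]
  · rw [hermForm, hconj, ← sub_add_cancel B ((c : ℂ) • Ipq p q), hP]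
    conv_lhs => rw [hJ, ← Matrix.smul_mul, ← Matrix.mul_smul, ← Matrix.add_mul]
    congr 1
    rw [← Matrix.mul_one h, Matrix.mul_assoc, ← Matrix.mul_add, Matrix.one_mul, ← diagonal_smul,
      ← diagonal_one, diagonal_add, Matrix.mul_assoc, diagonal_mul_diagonal]
    congr 2
    ext i
    have hs : sgn p q i * m i * (sgn p q i * (c + (m i)⁻¹)) = 1 + c * m i := by
      have h1 := sgn_mul_self p q i
      have h2 := mul_inv_cancel₀ (hm i)
      calc _ = (sgn p q i * sgn p q i) * (m i * c + m i * (m i)⁻¹) := by ring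
        _ = _ := by rw [h1, h2]; ring
    rw [hs]
    simp

theorem diagonal_ofReal_mul_inv {κ : Type*} [Fintype κ] [DecidableEq κ] {d : κ → ℝ}
    (hd : ∀ i, d i ≠ 0) :
    (diagonal fun i => (d i : ℂ)) * (diagonal fun i => (d i : ℂ)⁻¹) = 1 := by
  rw [diagonal_mul_diagonal, ← diagonal_one]
  congr 1
  ext i
  exact mul_inv_cancel₀ (by exact_mod_cast hd i)

theorem det_bordered_diagonal {κ : Type*} [Fintype κ] [DecidableEq κ] (d v : κ → ℝ) (b : ℝ)
    (hd : ∀ i, d i ≠ 0) :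
    (fromBlocks (diagonal fun i => (d i : ℂ)) (of fun i (_ : Unit) => (v i : ℂ))
      (of fun i (_ : Unit) => (v i : ℂ))ᴴ (of fun _ _ => (b : ℂ))).det =
      (((∏ i, d i) * (b - ∑ i, v i * v i / d i) : ℝ) : ℂ) := by
  have hu := diagonal_ofReal_mul_inv hd
  let : Invertible (diagonal fun i => (d i : ℂ)) := ⟨_, mul_eq_one_comm.1 hu, hu⟩
  rw [det_fromBlocks₁₁, invOf_eq_right_inv hu, det_diagonal, det_unique]
  simp [Matrix.mul_apply, diagonal_apply, div_eq_mul_inv, mul_right_comm]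

theorem posDef_bordered_diagonal {κ : Type*} [Fintype κ] [DecidableEq κ] (d v : κ → ℝ) (b : ℝ)
    (hd : ∀ i, 0 < d i) (hb : 0 < b - ∑ i, v i * v i / d i) :
    (fromBlocks (diagonal fun i => (d i : ℂ)) (of fun i (_ : Unit) => (v i : ℂ))
      (of fun i (_ : Unit) => (v i : ℂ))ᴴ (of fun _ _ => (b : ℂ))).PosDef := by
  have hu := diagonal_ofReal_mul_inv fun i => (hd i).ne'
  let : Invertible (diagonal fun i => (d i : ℂ)) := ⟨_, mul_eq_one_comm.1 hu, hu⟩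
  have hdp : (diagonal fun i => (d i : ℂ)).PosDef :=
    Matrix.PosDef.diagonal fun i => by exact_mod_cast hd i
  rw [Matrix.PosSemidef.posDef_iff_det_ne_zero, det_bordered_diagonal d v b fun i => (hd i).ne']
  · exact_mod_cast (mul_pos (Finset.prod_pos fun i _ => hd i) hb).ne'
  · rw [Matrix.PosDef.fromBlocks₁₁ _ _ hdp, Matrix.inv_eq_right_inv hu]
    have heq : (of fun _ _ => (b : ℂ)) - (of fun i (_ : Unit) => (v i : ℂ))ᴴ *
        (diagonal fun i => (d i : ℂ)⁻¹) * (of fun i (_ : Unit) => (v i : ℂ)) =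
        diagonal fun _ => ((b - ∑ i, v i * v i / d i : ℝ) : ℂ) := by
      ext i j
      simp [Matrix.mul_apply, diagonal_apply, div_eq_mul_inv, mul_right_comm]
    rw [heq]
    exact Matrix.PosSemidef.diagonal fun _ => Complex.zero_le_real.2 hb.le

theorem val_embed_of_lt {p q : ℕ} {i : Fin (p + q)} (h : (i : ℕ) < p) :
    (embed p q i : ℕ) = i := by
  rw [embed, if_pos h]

theorem val_embed_of_le {p q : ℕ} {i : Fin (p + q)} (h : p ≤ (i : ℕ)) :
    (embed p q i : ℕ) = i + 1 := by
  rw [embed, if_neg h.not_gt]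

theorem embed_strictMono (p q : ℕ) : StrictMono (embed p q) := by
  intro i j hij
  have hij' : (i : ℕ) < j := hij
  rw [Fin.lt_def]
  unfold embed
  split_ifs <;> simp only <;> omega

theorem sgn_embed (p q : ℕ) (i : Fin (p + q)) : sgn (p + 1) q (embed p q i) = sgn p q i := by
  unfold sgn embed
  split_ifs <;> simp_all <;> omega

/-- The index deleted by `projMat`. -/
def mid (p q : ℕ) : Fin (p + 1 + q) := ⟨p, by omega⟩

theorem embed_sum_mid_bijective (p q : ℕ) :
    Function.Bijective (Sum.elim (embed p q) fun _ : Unit => mid p q) := by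
  rw [Fintype.bijective_iff_injective_and_card]
  refine ⟨(embed_strictMono p q).injective.sumElim (Function.injective_of_subsingleton _) ?_, ?_⟩
  · intro i _ h
    have h' : (embed p q i : ℕ) = p := congrArg Fin.val h
    rcases lt_or_ge (i : ℕ) p with hi | hi
    · rw [val_embed_of_lt hi] at h'; omega
    · rw [val_embed_of_le hi] at h'; omega
  · simp only [Fintype.card_sum, Fintype.card_fin, Fintype.card_unit]
    omega

/-- The splitting of the indices into those kept and the one deleted by `projMat`. -/
noncomputable def splitEquiv (p q : ℕ) : Fin (p + q) ⊕ Unit ≃ Fin (p + 1 + q) :=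
  Equiv.ofBijective _ (embed_sum_mid_bijective p q)

theorem splitEquiv_symm_embed (p q : ℕ) (i : Fin (p + q)) :
    (splitEquiv p q).symm (embed p q i) = Sum.inl i :=
  (Equiv.symm_apply_eq _).2 rfl

theorem projMat_smul_mul_Ipq (p q : ℕ) (A : Matrix (Fin (p + 1 + q)) (Fin (p + 1 + q)) ℂ) :
    projMat p q (Complex.I • (A * Ipq (p + 1) q)) =
      Complex.I • (A.submatrix (embed p q) (embed p q) * Ipq p q) := by
  ext i j
  simp [projMat, Ipq_eq, Matrix.mul_diagonal, sgn_embed]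

theorem Ipq_submatrix_embed (p q : ℕ) :
    (Ipq (p + 1) q).submatrix (embed p q) (embed p q) = Ipq p q := by
  rw [Ipq_eq, Ipq_eq, submatrix_diagonal _ _ (embed_strictMono p q).injective]
  congr 1
  ext i
  simp [sgn_embed]

theorem one_mem_Upq (p q : ℕ) : (1 : Matrix (Fin (p + q)) (Fin (p + q)) ℂ) ∈ Upq p q :=
  mem_Upq_of_mul_eq (by simp)

theorem hermForm_one (p q : ℕ) (x : Fin (p + q) → ℝ) :
    hermForm p q 1 x = diagonal (fun i => ((sgn p q i * x i : ℝ) : ℂ)) := by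
  simp [hermForm]

theorem projMat_conj_eq_iff {p q : ℕ} {g : Matrix (Fin (p + 1 + q)) (Fin (p + 1 + q)) ℂ}
    (hg : g ∈ Upq (p + 1) q) (y : Fin (p + 1 + q) → ℝ)
    {k : Matrix (Fin (p + q)) (Fin (p + q)) ℂ} (hk : k ∈ Upq p q) (x : Fin (p + q) → ℝ) :
    projMat p q (g * dmat y * g⁻¹) = k * dmat x * k⁻¹ ↔
      (hermForm (p + 1) q g y).submatrix (embed p q) (embed p q) = hermForm p q k x := by
  rw [conj_dmat_eq hg, conj_dmat_eq hk, projMat_smul_mul_Ipq]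
  refine ⟨fun h => ?_, fun h => by rw [h]⟩
  have h1 := congrArg (· * Ipq p q) (smul_right_injective _ Complex.I_ne_zero h)
  simpa [Matrix.mul_assoc, Ipq_mul_self] using h1

theorem projMat_conj_eq_dmat_iff {p q : ℕ} {g : Matrix (Fin (p + 1 + q)) (Fin (p + 1 + q)) ℂ}
    (hg : g ∈ Upq (p + 1) q) (y : Fin (p + 1 + q) → ℝ) (x : Fin (p + q) → ℝ) :
    projMat p q (g * dmat y * g⁻¹) = dmat x ↔
      (hermForm (p + 1) q g y).submatrix (embed p q) (embed p q) = hermForm p q 1 x := by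
  rw [← projMat_conj_eq_iff hg y (one_mem_Upq p q) x]
  simp

theorem exists_separating {p q : ℕ} (hq : 1 ≤ q) {y : Fin (p + 1 + q) → ℝ}
    (hy : y ∈ Chol (p + 1) q) :
    ∃ c, (∀ j : Fin (p + 1 + q), (j : ℕ) ≤ p → c < y j) ∧
      ∀ j : Fin (p + 1 + q), p < (j : ℕ) → y j < c := by
  have hlt := hy.2 (mid p q) ⟨p + 1, by omega⟩ (Nat.lt_succ_self p) le_rfl
  refine ⟨(y (mid p q) + y ⟨p + 1, by omega⟩) / 2, fun j hj => ?_, fun j hj => ?_⟩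
  · have := antitone_of_mem_Chol hy (show j ≤ mid p q from hj)
    linarith
  · have := antitone_of_mem_Chol hy (show ⟨p + 1, by omega⟩ ≤ j from hj)
    linarith

theorem sgn_mul_sub_pos {p q : ℕ} {x : Fin (p + q) → ℝ} {c : ℝ}
    (h₁ : ∀ j : Fin (p + q), (j : ℕ) < p → c < x j)
    (h₂ : ∀ j : Fin (p + q), p ≤ (j : ℕ) → x j < c) (j : Fin (p + q)) :
    0 < sgn p q j * (x j - c) := by
  rcases lt_or_ge (j : ℕ) p with hj | hj
  · rw [sgn_of_lt hj]; linarith [h₁ j hj]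
  · rw [sgn_of_le hj]; linarith [h₂ j hj]

theorem existsUnique_orbit {p q : ℕ} (hq : 1 ≤ q) {y : Fin (p + 1 + q) → ℝ}
    (hy : y ∈ Chol (p + 1) q) {g : Matrix (Fin (p + 1 + q)) (Fin (p + 1 + q)) ℂ}
    (hg : g ∈ Upq (p + 1) q) :
    ∃! x : Fin (p + q) → ℝ,
      x ∈ Chol p q ∧ projMat p q (g * dmat y * g⁻¹) ∈ Orbit p q x := by
  obtain ⟨c, hc₁, hc₂⟩ := exists_separating hq hy
  have hpd : ((hermForm (p + 1) q g y).submatrix (embed p q) (embed p q) -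
      (c : ℂ) • Ipq p q).PosDef := by
    have := (posDef_hermForm hg (sgn_mul_sub_pos (fun j hj => hc₁ j (Nat.lt_succ_iff.1 hj))
      hc₂)).submatrix (embed_strictMono p q).injective
    rwa [← hermForm_sub hg, submatrix_sub, Pi.sub_apply, Pi.sub_apply, submatrix_smul,
      Pi.smul_apply, Pi.smul_apply, Ipq_submatrix_embed] at this
  obtain ⟨x, hx, k, hk, hxk⟩ := exists_eq_hermForm hpd
  refine ⟨x, ⟨hx, k, hk, (projMat_conj_eq_iff hg y hk x).2 hxk⟩, ?_⟩
  rintro x' ⟨hx', k', hk', hxk'⟩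
  rw [projMat_conj_eq_iff hg y hk' x', hxk] at hxk'
  exact eq_of_hermForm_eq hk' hk hx' hx hxk'.symm

/-- The interlacing inequalities describing the projection of the orbit of `dmat y`. -/
def Interlaces (p q : ℕ) (y : Fin (p + 1 + q) → ℝ) (x : Fin (p + q) → ℝ) : Prop :=
  (∀ i k : Fin (p + q), k ≤ i → x i ≤ y (embed p q k)) ∧
    (∀ i k : Fin (p + q), i < k → y (embed p q k) ≤ x i) ∧
    ∀ i : Fin (p + q), (i : ℕ) < p → y (mid p q) ≤ x i

theorem interlaces_of_submatrix_eq {p q : ℕ} (hq : 1 ≤ q) {y : Fin (p + 1 + q) → ℝ}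
    (hy : y ∈ Chol (p + 1) q) {x : Fin (p + q) → ℝ} (hx : x ∈ Chol p q)
    {g : Matrix (Fin (p + 1 + q)) (Fin (p + 1 + q)) ℂ} (hg : g ∈ Upq (p + 1) q)
    (h : (hermForm (p + 1) q g y).submatrix (embed p q) (embed p q) = hermForm p q 1 x) :
    Interlaces p q y x := by
  have hinj := (embed_strictMono p q).injective
  have hsub : ∀ l : ℝ, (hermForm (p + 1) q g fun j => y j - l).submatrix (embed p q) (embed p q) =
      diagonal fun i => ((sgn p q i * (x i - l) : ℝ) : ℂ) := fun l => by
    rw [← hermForm_sub hg, submatrix_sub, Pi.sub_apply, Pi.sub_apply, submatrix_smul,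
      Pi.smul_apply, Pi.smul_apply, Ipq_submatrix_embed, h, hermForm_sub (one_mem_Upq p q),
      hermForm_one]
  obtain ⟨c, hc₁, hc₂⟩ := exists_separating hq hy
  have hxc : ∀ i, 0 < sgn p q i * (x i - c) := by
    intro i
    have := ((posDef_hermForm hg (sgn_mul_sub_pos (fun j hj => hc₁ j (Nat.lt_succ_iff.1 hj))
      hc₂)).submatrix hinj).diag_pos (i := i)
    rw [hsub c, diagonal_apply_eq] at this
    exact_mod_cast this
  have hxc₁ : ∀ i : Fin (p + q), (i : ℕ) < p → c < x i := fun i hi => by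
    have := hxc i
    rw [sgn_of_lt hi] at this
    linarith
  have hxc₂ : ∀ i : Fin (p + q), p ≤ (i : ℕ) → x i < c := fun i hi => by
    have := hxc i
    rw [sgn_of_le hi] at this
    linarith
  have hxa := antitone_of_mem_Chol hx
  have hya := antitone_of_mem_Chol hy
  have upper : ∀ i, x i ≤ y (embed p q i) := by
    intro i
    by_contra! hlt
    obtain ⟨l, hl₁, hl₂⟩ := exists_between hlt
    rcases lt_or_ge (i : ℕ) p with hi | hi
    · have hei := val_embed_of_lt hi
      have hcl : c < l := (hc₁ _ (by omega)).trans hl₁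
      have := card_add_card_le_of_neg_of_pos hg.1 hinj rfl (hsub l)
        (S := Finset.univ.filter fun k => ¬((i : ℕ) + 1 ≤ k ∧ (k : ℕ) < p))
        (T := Finset.univ.filter fun j => (i : ℕ) ≤ j ∧ (j : ℕ) < p + 1)
        (fun j hj => by
          have hj := (Finset.mem_filter.1 hj).2
          have h1 := hya (show embed p q i ≤ j by rw [Fin.le_def]; omega)
          rw [sgn_of_lt hj.2]; linarith)
        (fun k hk => by
          have hk := (Finset.mem_filter.1 hk).2
          rcases lt_or_ge (k : ℕ) p with hkp | hkp
          · have h1 := hxa (show k ≤ i by rw [Fin.le_def]; omega)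
            rw [sgn_of_lt hkp]; linarith
          · have h1 := hxc₂ k hkp
            rw [sgn_of_le hkp]; linarith)
      rw [card_filter_not_Ico _ _ (by omega), card_filter_Ico _ _ (by omega), Fintype.card_fin] at this
      omega
    · have hei := val_embed_of_le hi
      have hcl : l < c := hl₂.trans (hxc₂ i hi)
      have := card_add_card_le_of_pos_of_neg hg.1 hinj rfl (hsub l)
        (S := Finset.univ.filter fun k => p ≤ (k : ℕ) ∧ (k : ℕ) < i + 1)
        (T := Finset.univ.filter fun j => ¬(p + 1 ≤ (j : ℕ) ∧ (j : ℕ) < i + 1))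
        (fun j hj => by
          have hj := (Finset.mem_filter.1 hj).2
          rcases lt_or_ge (j : ℕ) (p + 1) with hjp | hjp
          · have h1 := hc₁ j (by omega)
            rw [sgn_of_lt hjp]; linarith
          · have h1 := hya (show embed p q i ≤ j by rw [Fin.le_def]; omega)
            rw [sgn_of_le hjp]; linarith)
        (fun k hk => by
          have hk := (Finset.mem_filter.1 hk).2
          have h1 := hxa (show k ≤ i by rw [Fin.le_def]; omega)
          rw [sgn_of_le hk.1]; linarith)
      rw [card_filter_not_Ico _ _ (by omega), card_filter_Ico _ _ (by omega), Fintype.card_fin] at this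
      omega
  have lower₁ : ∀ (i : Fin (p + q)) (m : Fin (p + 1 + q)), (i : ℕ) < p → (i : ℕ) < m →
      (m : ℕ) ≤ p → y m ≤ x i := by
    intro i m hi him hm
    by_contra! hlt
    obtain ⟨l, hl₁, hl₂⟩ := exists_between hlt
    have hcl : c < l := (hxc₁ i hi).trans hl₁
    have := card_add_card_le_of_pos_of_neg hg.1 hinj rfl (hsub l)
      (S := Finset.univ.filter fun k => (i : ℕ) ≤ k ∧ (k : ℕ) < p)
      (T := Finset.univ.filter fun j => ¬((m : ℕ) + 1 ≤ j ∧ (j : ℕ) < p + 1))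
      (fun j hj => by
        have hj := (Finset.mem_filter.1 hj).2
        rcases lt_or_ge (j : ℕ) (p + 1) with hjp | hjp
        · have h1 := hya (show j ≤ m by rw [Fin.le_def]; omega)
          rw [sgn_of_lt hjp]; linarith
        · have h1 := hc₂ j hjp
          rw [sgn_of_le hjp]; linarith)
      (fun k hk => by
        have hk := (Finset.mem_filter.1 hk).2
        have h1 := hxa (show i ≤ k from hk.1)
        rw [sgn_of_lt hk.2]; linarith)
    rw [card_filter_not_Ico _ _ (by omega), card_filter_Ico _ _ (by omega), Fintype.card_fin] at this
    omega
  refine ⟨fun i k hki => (upper i).trans (hya ((embed_strictMono p q).monotone hki)),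
    fun i k hik => ?_, fun i hi => lower₁ i _ hi hi le_rfl⟩
  have hik' : (i : ℕ) < k := hik
  rcases lt_or_ge (k : ℕ) p with hk | hk
  · have hek := val_embed_of_lt hk
    exact lower₁ i _ (by omega) (by omega) (by omega)
  have hek := val_embed_of_le hk
  rcases lt_or_ge (i : ℕ) p with hi | hi
  · exact ((hc₂ _ (by omega)).trans (hxc₁ i hi)).le
  by_contra! hlt
  obtain ⟨l, hl₁, hl₂⟩ := exists_between hlt
  have hcl : l < c := hl₂.trans (hc₂ _ (by omega))
  have := card_add_card_le_of_neg_of_pos hg.1 hinj rfl (hsub l)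
    (S := Finset.univ.filter fun k => ¬(p ≤ (k : ℕ) ∧ (k : ℕ) < i))
    (T := Finset.univ.filter fun j => p + 1 ≤ (j : ℕ) ∧ (j : ℕ) < k + 2)
    (fun j hj => by
      have hj := (Finset.mem_filter.1 hj).2
      have h1 := hya (show j ≤ embed p q k by rw [Fin.le_def]; omega)
      rw [sgn_of_le hj.1]; linarith)
    (fun k hk => by
      have hk := (Finset.mem_filter.1 hk).2
      rcases lt_or_ge (k : ℕ) p with hkp | hkp
      · have h1 := hxc₁ k hkp
        rw [sgn_of_lt hkp]; linarith
      · have h1 := hxa (show i ≤ k by rw [Fin.le_def]; omega)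
        rw [sgn_of_le hkp]; linarith)
  rw [card_filter_not_Ico _ _ (by omega), card_filter_Ico _ _ (by omega), Fintype.card_fin] at this
  omega

theorem Interlaces.lt_of_lt {p q : ℕ} {y : Fin (p + 1 + q) → ℝ} {x : Fin (p + q) → ℝ}
    (h : Interlaces p q y x) {c : ℝ} (hc : ∀ j : Fin (p + 1 + q), (j : ℕ) ≤ p → c < y j)
    {i : Fin (p + q)} (hi : (i : ℕ) < p) : c < x i :=
  (hc (mid p q) le_rfl).trans_le (h.2.2 i hi)

theorem Interlaces.lt_of_le {p q : ℕ} {y : Fin (p + 1 + q) → ℝ} {x : Fin (p + q) → ℝ}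
    (h : Interlaces p q y x) {c : ℝ} (hc : ∀ j : Fin (p + 1 + q), p < (j : ℕ) → y j < c)
    {i : Fin (p + q)} (hi : p ≤ (i : ℕ)) : x i < c :=
  (h.1 i i le_rfl).trans_lt (hc _ (by rw [val_embed_of_le hi]; omega))

theorem Interlaces.mem_Chol {p q : ℕ} (hq : 1 ≤ q) {y : Fin (p + 1 + q) → ℝ}
    (hy : y ∈ Chol (p + 1) q) {x : Fin (p + q) → ℝ} (h : Interlaces p q y x) : x ∈ Chol p q := by
  obtain ⟨c, hc₁, hc₂⟩ := exists_separating hq hy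
  refine ⟨fun i j hij _ => ?_, fun i j hi hj => (h.lt_of_le hc₂ hj).trans (h.lt_of_lt hc₁ hi)⟩
  rcases (show i ≤ j from hij).eq_or_lt with rfl | hij
  · exact le_rfl
  · exact (h.1 j j le_rfl).trans (h.2.1 i j hij)

/-- The secular equation: interlacing data give nonnegative weights of a bordered matrix. -/
theorem Interlaces.exists_weights {p q : ℕ} (hq : 1 ≤ q) {y : Fin (p + 1 + q) → ℝ}
    (hy : y ∈ Chol (p + 1) q) {x : Fin (p + q) → ℝ} (h : Interlaces p q y x) :
    ∃ (a : ℝ) (w : Fin (p + q) → ℝ), (∀ i, 0 ≤ w i) ∧ ∀ l : ℝ, (∀ k, l ≠ x k) →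
      (l - y (mid p q)) * ∏ k, (l - y (embed p q k)) / (l - x k) =
        l - a - ∑ i, sgn p q i * w i / (l - x i) := by
  obtain ⟨c, hc₁, hc₂⟩ := exists_separating hq hy
  have hxa := antitone_of_mem_Chol (h.mem_Chol hq hy)
  let S : Finset (Fin (p + q)) := Finset.univ.filter fun k => ∀ k' < k, x k' ≠ x k
  have hS : Set.InjOn x S := by
    intro i hi j hj hij
    have hi := (Finset.mem_filter.1 hi).2
    have hj := (Finset.mem_filter.1 hj).2
    rcases lt_trichotomy i j with hlt | heq | hlt
    · exact absurd hij (hj i hlt)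
    · exact heq
    · exact absurd hij.symm (hi j hlt)
  have hnS : ∀ k ∉ S, y (embed p q k) = x k := by
    intro k hk
    simp only [S, Finset.mem_filter, Finset.mem_univ, true_and] at hk
    push Not at hk
    obtain ⟨k', hk', hxk⟩ := hk
    exact le_antisymm (hxk ▸ h.2.1 k' k hk') (h.1 k k le_rfl)
  let r : Fin (p + q) → ℝ := fun i => (x i - y (mid p q)) * (x i - y (embed p q i)) *
    ∏ k ∈ S.erase i, (x i - y (embed p q k)) / (x i - x k)
  have hr : ∀ i, 0 ≤ -(sgn p q i * r i) := by
    intro i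
    have hP : 0 ≤ ∏ k ∈ S.erase i, (x i - y (embed p q k)) / (x i - x k) := by
      refine Finset.prod_nonneg fun k hk => ?_
      rcases lt_or_gt_of_ne (Finset.ne_of_mem_erase hk) with hki | hki
      · exact div_nonneg_of_nonpos (sub_nonpos.2 (h.1 i k hki.le)) (sub_nonpos.2 (hxa hki.le))
      · exact div_nonneg (sub_nonneg.2 (h.2.1 i k hki)) (sub_nonneg.2 (hxa hki.le))
    have h1 := sub_nonpos.2 (h.1 i i le_rfl)
    rcases lt_or_ge (i : ℕ) p with hi | hi
    · have h2 := mul_nonpos_of_nonneg_of_nonpos (sub_nonneg.2 (h.2.2 i hi)) h1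
      have h3 := mul_nonpos_of_nonpos_of_nonneg h2 hP
      rw [sgn_of_lt hi]; linarith
    · have h0 := (h.lt_of_le hc₂ hi).trans (hc₁ (mid p q) le_rfl)
      have h3 := mul_nonneg (mul_nonneg_of_nonpos_of_nonpos (sub_nonpos.2 h0.le) h1) hP
      rw [sgn_of_le hi]; linarith
  obtain ⟨a, ha⟩ := exists_partial_fractions S x (fun k => y (embed p q k)) (y (mid p q)) hS
  refine ⟨a, fun i => if i ∈ S then -(sgn p q i * r i) else 0, fun i => ?_, fun l hl => ?_⟩
  · simp only
    split_ifs
    · exact hr i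
    · exact le_rfl
  · have hprod : ∏ k, (l - y (embed p q k)) / (l - x k) =
        ∏ k ∈ S, (l - y (embed p q k)) / (l - x k) := by
      refine (Finset.prod_subset (Finset.subset_univ S) fun k _ hk => ?_).symm
      rw [hnS k hk, div_self (sub_ne_zero.2 (hl k))]
    have hsum : ∑ i, sgn p q i * (if i ∈ S then -(sgn p q i * r i) else 0) / (l - x i) =
        ∑ i ∈ S, -(r i / (l - x i)) := by
      rw [← Finset.sum_subset (Finset.subset_univ S)]
      · refine Finset.sum_congr rfl fun i hi => ?_
        rw [if_pos hi, mul_neg, ← mul_assoc, sgn_mul_self, one_mul, neg_div]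
      · intro i _ hi
        simp [hi]
    rw [hprod, ha l fun k _ => hl k, hsum, Finset.sum_neg_distrib, sub_neg_eq_add]

theorem Interlaces.exists_submatrix_eq {p q : ℕ} (hq : 1 ≤ q) {y : Fin (p + 1 + q) → ℝ}
    (hy : y ∈ Chol (p + 1) q) {x : Fin (p + q) → ℝ} (h : Interlaces p q y x) :
    ∃ g ∈ Upq (p + 1) q,
      (hermForm (p + 1) q g y).submatrix (embed p q) (embed p q) = hermForm p q 1 x := by
  obtain ⟨c, hc₁, hc₂⟩ := exists_separating hq hy
  obtain ⟨a, w, hw, hid⟩ := h.exists_weights hq hy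
  let v : Fin (p + q) → ℝ := fun i => √(w i)
  let M : ℝ → Matrix (Fin (p + q) ⊕ Unit) (Fin (p + q) ⊕ Unit) ℂ := fun l =>
    fromBlocks (diagonal fun i => ((sgn p q i * (x i - l) : ℝ) : ℂ))
      (of fun i (_ : Unit) => (v i : ℂ)) (of fun i (_ : Unit) => (v i : ℂ))ᴴ
      (of fun _ _ => ((a - l : ℝ) : ℂ))
  let A := (M 0).submatrix (splitEquiv p q).symm (splitEquiv p q).symm
  have hA : ∀ l : ℝ, A - (l : ℂ) • Ipq (p + 1) q =
      (M l).submatrix (splitEquiv p q).symm (splitEquiv p q).symm := by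
    intro l
    have hI : Ipq (p + 1) q = (fromBlocks (Ipq p q) 0 0 (1 : Matrix Unit Unit ℂ)).submatrix
        (splitEquiv p q).symm (splitEquiv p q).symm := by
      rw [Ipq_eq p q, ← diagonal_one, fromBlocks_diagonal, submatrix_diagonal_equiv, Ipq_eq]
      congr 1
      ext j
      obtain ⟨j, rfl⟩ := (splitEquiv p q).surjective j
      rw [Function.comp_apply, Equiv.symm_apply_apply]
      rcases j with j | j
      · exact congrArg _ (sgn_embed p q j)
      · have : sgn (p + 1) q (splitEquiv p q (Sum.inr j)) = 1 :=
          sgn_of_lt (Nat.lt_succ_self p)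
        simp [this]
    have hM : M l = M 0 - (l : ℂ) • fromBlocks (Ipq p q) 0 0 (1 : Matrix Unit Unit ℂ) := by
      ext i j
      rcases i with i | i <;> rcases j with j | j
      · by_cases hij : i = j
        · simp [M, Ipq_eq, hij]; ring
        · simp [M, Ipq_eq, hij]
      · simp [M]
      · simp [M]
      · simp [M]
    rw [hI, hM]
    rfl
  have hschur : ∀ l : ℝ, (∀ k, l ≠ x k) →
      (a - l) - ∑ i, v i * v i / (sgn p q i * (x i - l)) =
        (y (mid p q) - l) * ∏ k, (y (embed p q k) - l) / (x k - l) := by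
    intro l hl
    have h1 : ∀ i, v i * v i / (sgn p q i * (x i - l)) = -(sgn p q i * w i / (l - x i)) := by
      intro i
      have h2 : l - x i ≠ 0 := sub_ne_zero.2 (hl i)
      have h3 := sgn_ne_zero p q i
      have h4 := sgn_mul_self p q i
      rw [Real.mul_self_sqrt (hw i), ← neg_sub l, ← div_neg, div_eq_div_iff
        (mul_ne_zero h3 (neg_ne_zero.2 h2)) (neg_ne_zero.2 h2)]
      linear_combination (w i * (l - x i)) * h4
    have h5 : ∀ k, (y (embed p q k) - l) / (x k - l) = (l - y (embed p q k)) / (l - x k) :=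
      fun k => by rw [← neg_sub l, ← neg_sub l, neg_div_neg_eq]
    simp only [h1, h5, Finset.sum_neg_distrib]
    linear_combination hid l hl
  have hcx : ∀ i, 0 < sgn p q i * (x i - c) :=
    sgn_mul_sub_pos (fun i hi => h.lt_of_lt hc₁ hi) (fun i hi => h.lt_of_le hc₂ hi)
  have hcy : ∀ j, 0 < sgn (p + 1) q j * (y j - c) :=
    sgn_mul_sub_pos (fun j hj => hc₁ j (Nat.lt_succ_iff.1 hj)) hc₂
  have hpd : (A - (c : ℂ) • Ipq (p + 1) q).PosDef := by
    rw [hA]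
    refine Matrix.PosDef.submatrix ?_ (splitEquiv p q).symm.injective
    refine posDef_bordered_diagonal _ _ _ hcx ?_
    rw [hschur c fun k hk => by simpa [hk] using hcx k]
    refine mul_pos (sub_pos.2 (hc₁ _ le_rfl)) (Finset.prod_pos fun k _ => ?_)
    have h1 := hcy (embed p q k)
    rw [sgn_embed] at h1
    have h2 := div_pos h1 (hcx k)
    rwa [mul_div_mul_left _ _ (sgn_ne_zero p q k)] at h2
  obtain ⟨y', hy', g, hg, hAg⟩ := exists_eq_hermForm hpd
  have hyy : y' = y := by
    refine eq_of_prod_sgn_mul_sub_eq hy' hy (Set.range x) (Set.finite_range x) fun l hl => ?_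
    have hl' : ∀ k, l ≠ x k := fun k hk => hl ⟨k, hk.symm⟩
    have h1 := det_hermForm hg fun i => y' i - l
    rw [← hermForm_sub hg, ← hAg, hA, det_submatrix_equiv_self, det_bordered_diagonal _ _ _
      (fun i => mul_ne_zero (sgn_ne_zero p q i) (sub_ne_zero.2 (hl' i).symm)), hschur l hl'] at h1
    rw [← Complex.ofReal_injective h1, ← (splitEquiv p q).prod_comp, Fintype.prod_sum_type,
      mul_left_comm, ← Finset.prod_mul_distrib, mul_comm]
    have h2 : ∀ j : Unit, splitEquiv p q (Sum.inr j) = mid p q := fun _ => rfl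
    have h3 : ∀ k, splitEquiv p q (Sum.inl k) = embed p q k := fun _ => rfl
    have h4 : sgn (p + 1) q (mid p q) = 1 := sgn_of_lt (Nat.lt_succ_self p)
    simp only [h2, h3, h4, sgn_embed, Finset.univ_unique, Finset.prod_singleton, one_mul]
    congr 1
    refine Finset.prod_congr rfl fun k _ => ?_
    rw [mul_assoc, mul_div_cancel₀ _ (sub_ne_zero.2 (hl' k).symm)]
  refine ⟨g, hg, ?_⟩
  rw [← hyy, ← hAg, hermForm_one]
  ext i j
  simp [A, M, splitEquiv_symm_embed]

theorem setOf_projection_eq {p q : ℕ} (hq : 1 ≤ q) {y : Fin (p + 1 + q) → ℝ}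
    (hy : y ∈ Chol (p + 1) q) :
    {x | x ∈ Chol p q ∧ ∃ g ∈ Upq (p + 1) q, projMat p q (g * dmat y * g⁻¹) = dmat x} =
      {x | Interlaces p q y x} := by
  ext x
  constructor
  · rintro ⟨hx, g, hg, hgx⟩
    exact interlaces_of_submatrix_eq hq hy hx hg ((projMat_conj_eq_dmat_iff hg y x).1 hgx)
  · intro h
    obtain ⟨g, hg, hgx⟩ := Interlaces.exists_submatrix_eq hq hy h
    exact ⟨h.mem_Chol hq hy, g, hg, (projMat_conj_eq_dmat_iff hg y x).2 hgx⟩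

theorem convex_interlaces (p q : ℕ) (y : Fin (p + 1 + q) → ℝ) :
    Convex ℝ {x | Interlaces p q y x} := by
  intro x hx x' hx' s t hs ht hst
  have hcomb : ∀ b : ℝ, b = s * b + t * b := fun b => by rw [← add_mul, hst, one_mul]
  refine ⟨fun i k hk => ?_, fun i k hk => ?_, fun i hi => ?_⟩
  · rw [hcomb (y _)]
    exact add_le_add (mul_le_mul_of_nonneg_left (hx.1 i k hk) hs)
      (mul_le_mul_of_nonneg_left (hx'.1 i k hk) ht)
  · rw [hcomb (y _)]
    exact add_le_add (mul_le_mul_of_nonneg_left (hx.2.1 i k hk) hs)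
      (mul_le_mul_of_nonneg_left (hx'.2.1 i k hk) ht)
  · rw [hcomb (y _)]
    exact add_le_add (mul_le_mul_of_nonneg_left (hx.2.2 i hi) hs)
      (mul_le_mul_of_nonneg_left (hx'.2.2 i hi) ht)

theorem isClosed_interlaces (p q : ℕ) (y : Fin (p + 1 + q) → ℝ) :
    IsClosed {x | Interlaces p q y x} := by
  simp only [Interlaces, Set.ofPred_and, Set.ofPred_forall]
  refine (isClosed_iInter fun i => isClosed_iInter fun k => isClosed_iInter fun _ => ?_).inter
    ((isClosed_iInter fun i => isClosed_iInter fun k => isClosed_iInter fun _ => ?_).inter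
      (isClosed_iInter fun i => isClosed_iInter fun _ => ?_))
  · exact isClosed_le (continuous_apply i) continuous_const
  · exact isClosed_le continuous_const (continuous_apply i)
  · exact isClosed_le continuous_const (continuous_apply i)

end

theorem statement3 (p q : ℕ) (hq : 1 ≤ q) (hpq : q ≤ p)
    (y : Fin (p + 1 + q) → ℝ) (hy : y ∈ Chol (p + 1) q) :
    (∀ g ∈ Upq (p + 1) q, ∃! x : Fin (p + q) → ℝ,
        x ∈ Chol p q ∧ projMat p q (g * dmat y * g⁻¹) ∈ Orbit p q x) ∧
    Convex ℝ {x | x ∈ Chol p q ∧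
        ∃ g ∈ Upq (p + 1) q, projMat p q (g * dmat y * g⁻¹) = dmat x} ∧
    IsClosed {x | x ∈ Chol p q ∧
        ∃ g ∈ Upq (p + 1) q, projMat p q (g * dmat y * g⁻¹) = dmat x} := by
  rw [setOf_projection_eq hq hy]
  exact ⟨fun g hg => existsUnique_orbit hq hy hg, convex_interlaces p q y, isClosed_interlaces p q y⟩
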